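/- Let R be a semiprime left Goldie ring and let σ be a ring endomorphism of R such that σ(C_R) ⊆ C_R. Then udim(R) = udim(σ(R)) + udim(ker(σ)), where udim denotes left uniform dimension (udim(σ(R)) is taken as a left σ(R)-module and udim(ker(σ)) as a left R-module). -/

import Mathlib

/-- A two-sided ideal `I` of a ring is nilpotent if for some `n ≥ 1` every product of
`n` elements of `I` vanishes. -/
def TwoSidedIdeal.IsNilpotentIdeal {R : Type*} [Ring R] (I : TwoSidedIdeal R) : Prop :=
  ∃ n : ℕ, 0 < n ∧ ∀ f : Fin n → R, (∀ i, f i ∈ I) → (List.ofFn f).prod = 0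

/-- A ring is semiprime if it has no nonzero nilpotent two-sided ideal. -/
def IsSemiprimeRing' (R : Type*) [Ring R] : Prop :=
  ∀ I : TwoSidedIdeal R, I.IsNilpotentIdeal → I = ⊥

/-- A ring has finite left uniform dimension if it contains no infinite direct sum of
nonzero left ideals. -/
def HasFiniteLeftUniformDimension (R : Type*) [Ring R] : Prop :=
  ¬ ∃ f : ℕ → Ideal R, (∀ n, f n ≠ ⊥) ∧ iSupIndep f

/-- The left annihilator of a subset `S` of a ring. -/
def leftAnnihilator (R : Type*) [Ring R] (S : Set R) : Set R :=
  {r : R | ∀ s ∈ S, r * s = 0}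

/-- The ascending chain condition on left annihilators. -/
def ACCLeftAnnihilators (R : Type*) [Ring R] : Prop :=
  ∀ f : ℕ → Set R, (∀ n, ∃ S : Set R, f n = leftAnnihilator R S) → Monotone f →
    ∃ N, ∀ n, N ≤ n → f n = f N

/-- A ring is a left Goldie ring if it has finite left uniform dimension and satisfies
the a.c.c. on left annihilators. -/
def IsLeftGoldieRing (R : Type*) [Ring R] : Prop :=
  HasFiniteLeftUniformDimension R ∧ ACCLeftAnnihilators R

/-- A left ideal is essential if it meets every nonzero left ideal nontrivially. -/
def IsEssentialLeftIdeal {R : Type*} [Ring R] (I : Ideal R) : Prop :=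
  ∀ J : Ideal R, J ≠ ⊥ → I ⊓ J ≠ ⊥

/-- A ring endomorphism has large image if its image contains an essential left ideal. -/
def HasLargeImage {R : Type*} [Ring R] (σ : R →+* R) : Prop :=
  ∃ I : Ideal R, IsEssentialLeftIdeal I ∧ (I : Set R) ⊆ Set.range σ

/-- The left uniform dimension of a module, with values in `ℕ∞`: the supremum of the
numbers `k` such that `M` contains a direct sum of `k` nonzero submodules. -/
noncomputable def udim (R : Type*) [Ring R] (M : Type*) [AddCommGroup M] [Module R M] : ℕ∞ :=
  sSup {n : ℕ∞ | ∃ (k : ℕ) (f : Fin k → Submodule R M),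
    n = (k : ℕ∞) ∧ (∀ i, f i ≠ ⊥) ∧ iSupIndep f}

/-- `DevLE α P` means that the deviation of the poset `P` is at most the ordinal `α`:
for every descending chain, all but finitely many of its factor intervals either are
trivial or have deviation at most some ordinal `β < α`. -/
def DevLE (α : Ordinal.{v}) (P : Type u) [Preorder P] : Prop :=
  ∀ f : ℕ → P, (∀ n, f (n + 1) ≤ f n) →
    ∃ N : ℕ, ∀ n, N ≤ n →
      (∀ x y : Set.Icc (f (n + 1)) (f n), x ≤ y → y ≤ x) ∨
      ∃ (β : Ordinal.{v}) (_ : β < α), DevLE β (Set.Icc (f (n + 1)) (f n))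
termination_by α

/-- A module has (Gabriel–Rentschler) Krull dimension if the deviation of its lattice of
submodules is defined, i.e. bounded by some ordinal. -/
def HasKrullDimGR (R : Type u) [Ring R] (M : Type v) [AddCommGroup M] [Module R M] : Prop :=
  ∃ α : Ordinal.{max u v}, DevLE α (Submodule R M)

/-- The Gabriel–Rentschler Krull dimension of a module: the least ordinal bounding the
deviation of its lattice of submodules. -/
noncomputable def krullDimGR (R : Type u) [Ring R] (M : Type v) [AddCommGroup M]
    [Module R M] : Ordinal.{max u v} :=
  sInf {α : Ordinal.{max u v} | DevLE α (Submodule R M)}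

section Ore

variable {R : Type*} [Ring R]

/-- A multiplicative subset: contains `1`, omits `0` and is closed under multiplication. -/
def IsMultSet (S : Set R) : Prop :=
  1 ∈ S ∧ 0 ∉ S ∧ ∀ s ∈ S, ∀ t ∈ S, s * t ∈ S

/-- A left Ore set: a multiplicative set satisfying the left Ore condition. -/
def IsLeftOreSet (S : Set R) : Prop :=
  IsMultSet S ∧ ∀ (r : R), ∀ s ∈ S, ∃ s' ∈ S, ∃ r' : R, s' * r = r' * s

/-- `assL S = { r | s r = 0 for some s ∈ S }`. -/
def assL (S : Set R) : Set R := {r : R | ∃ s ∈ S, s * r = 0}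

/-- A left denominator set: a left Ore set such that `r s = 0` with `s ∈ S` implies
`t r = 0` for some `t ∈ S`. -/
def IsLeftDenominatorSet (S : Set R) : Prop :=
  IsLeftOreSet S ∧ ∀ (r : R), ∀ s ∈ S, r * s = 0 → ∃ t ∈ S, t * r = 0

/-- `θ : R →+* Q` realizes `Q` as the left localization `S⁻¹R` of `R` at `S`:
elements of `S` become units, the kernel of `θ` is `assL S`, and every element of `Q`
has the form `θ(s)⁻¹ θ(r)`. -/
structure IsLeftLocalization {Q : Type*} [Ring Q] (S : Set R) (θ : R →+* Q) : Prop where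
  isUnit : ∀ s ∈ S, IsUnit (θ s)
  ker_eq : ∀ r : R, θ r = 0 ↔ r ∈ assL S
  exists_rep : ∀ q : Q, ∃ s ∈ S, ∃ r : R, θ s * q = θ r

end Ore

/-- A finite family of nonzero submodules is independent modulo `A` if it induces an
independent family of nonzero submodules of the quotient by `A`. -/
def IndepModulo {R M ι : Type*} [Ring R] [AddCommGroup M] [Module R M] [Fintype ι]
    (A : Submodule R M) (f : ι → Submodule R M) : Prop :=
  (∀ i, f i ≠ ⊥) ∧ ∀ y : ι → M, (∀ i, y i ∈ f i) → ∑ i, y i ∈ A → ∀ i, y i = 0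

section UniformDimension

variable {R M : Type*} [Ring R] [AddCommGroup M] [Module R M]

theorem iSupIndep_iff_forall_sum_eq_zero {ι : Type*} [Fintype ι] (f : ι → Submodule R M) :
    iSupIndep f ↔ ∀ y : ι → M, (∀ i, y i ∈ f i) → ∑ i, y i = 0 → ∀ i, y i = 0 := by
  classical
  rw [iSupIndep_iff_finsetSum_eq_zero_imp_eq_zero]
  refine ⟨fun h y hy h0 i => h Finset.univ y (fun i _ => hy i) h0 i (Finset.mem_univ i),
    fun h s v hv h0 i hi => ?_⟩
  have := h (fun i => if i ∈ s then v i else 0)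
    (fun i => by
      split_ifs with hs
      · exact hv i hs
      · exact zero_mem _)
    (by simpa using h0) i
  simpa [hi] using this

theorem indepModulo_bot {ι : Type*} [Fintype ι] (f : ι → Submodule R M) :
    IndepModulo ⊥ f ↔ (∀ i, f i ≠ ⊥) ∧ iSupIndep f := by
  simp [IndepModulo, iSupIndep_iff_forall_sum_eq_zero]

theorem IndepModulo.eq_zero_of_mem {ι : Type*} [Fintype ι] {A : Submodule R M}
    {f : ι → Submodule R M} (hf : IndepModulo A f) {i : ι} {x : M} (hx : x ∈ f i)
    (hxA : x ∈ A) : x = 0 := by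
  classical
  have := hf.2 (Pi.single i x)
    (fun j => by
      by_cases h : j = i
      · subst h; simpa using hx
      · simp [h])
    (by simpa using hxA) i
  simpa using this

theorem IndepModulo.natCast_le_udim {k : ℕ} {f : Fin k → Submodule R M}
    (hf : IndepModulo ⊥ f) : (k : ℕ∞) ≤ udim R M :=
  le_sSup ⟨k, f, rfl, (indepModulo_bot f).1 hf⟩

theorem udim_le {a : ℕ∞}
    (h : ∀ (k : ℕ) (f : Fin k → Submodule R M), IndepModulo ⊥ f → (k : ℕ∞) ≤ a) :
    udim R M ≤ a := by
  refine sSup_le ?_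
  rintro _ ⟨k, f, rfl, hf⟩
  exact h k f ((indepModulo_bot f).2 hf)

theorem udim_add_udim_le {S N : Type*} [Ring S] [AddCommGroup N] [Module S N] {a : ℕ∞}
    (h : ∀ (k l : ℕ) (f : Fin k → Submodule R M) (g : Fin l → Submodule S N),
      IndepModulo ⊥ f → IndepModulo ⊥ g → (k : ℕ∞) + l ≤ a) :
    udim R M + udim S N ≤ a := by
  rw [udim, udim, sSup_eq_iSup, sSup_eq_iSup]
  refine ENat.biSup_add_biSup_le
    (by exact ⟨0, 0, Fin.elim0, rfl, fun i => i.elim0, fun i => i.elim0⟩)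
    (by exact ⟨0, 0, Fin.elim0, rfl, fun i => i.elim0, fun i => i.elim0⟩) ?_
  rintro _ ⟨k, f, rfl, hf⟩ _ ⟨l, g, rfl, hg⟩
  exact h k l f g ((indepModulo_bot f).2 hf) ((indepModulo_bot g).2 hg)

theorem IndepModulo.append {a b : ℕ} {A : Submodule R M} {g : Fin a → Submodule R M}
    {h : Fin b → Submodule R M} (hg : IndepModulo ⊥ g) (hgA : ∀ i, g i ≤ A)
    (hh : IndepModulo A h) : IndepModulo ⊥ (Fin.append g h) := by
  refine ⟨fun i => ?_, fun y hy h0 => ?_⟩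
  · refine Fin.addCases (fun i => ?_) (fun i => ?_) i
    · simpa using hg.1 i
    · simpa using hh.1 i
  · rw [Fin.sum_univ_add, Submodule.mem_bot] at h0
    have hy1 : ∀ i, y (Fin.castAdd b i) ∈ g i := fun i => by
      simpa using hy (Fin.castAdd b i)
    have hy2 : ∀ i, y (Fin.natAdd a i) ∈ h i := fun i => by
      simpa using hy (Fin.natAdd a i)
    have h2 := hh.2 _ hy2 (by
      rw [eq_neg_of_add_eq_zero_right h0]
      exact neg_mem (sum_mem fun i _ => hgA i (hy1 i)))
    have h1 := hg.2 _ hy1 (by simpa [h2] using h0)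
    intro i
    exact Fin.addCases h1 h2 i

/-- An independent family can be traded for one of the same size, part of which lies in a
given submodule `A` while the other part is independent modulo `A`. -/
theorem IndepModulo.exists_split (A : Submodule R M) {n : ℕ} {f : Fin n → Submodule R M}
    (hf : IndepModulo ⊥ f) :
    ∃ (a b : ℕ) (g : Fin a → Submodule R M) (h : Fin b → Submodule R M), a + b = n ∧
      IndepModulo ⊥ g ∧ (∀ i, g i ≤ A) ∧ (∀ i, g i ≤ ⨆ k, f k) ∧
      IndepModulo A h ∧ (∀ i, h i ≤ ⨆ k, f k) := by
  induction n with
  | zero =>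
    exact ⟨0, 0, Fin.elim0, Fin.elim0, rfl, ⟨fun i => i.elim0, fun _ _ _ i => i.elim0⟩,
      fun i => i.elim0, fun i => i.elim0, ⟨fun i => i.elim0, fun _ _ _ i => i.elim0⟩,
      fun i => i.elim0⟩
  | succ n ih =>
    have hf' : IndepModulo ⊥ fun i : Fin n => f i.castSucc := by
      refine ⟨fun i => hf.1 _, fun y hy h0 i => ?_⟩
      have := hf.2 (Fin.snoc (α := fun _ => M) y 0)
        (fun i => by refine Fin.lastCases ?_ (fun i => ?_) i <;> simp [hy])
        (by simpa [Fin.sum_univ_castSucc] using h0) i.castSucc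
      simpa using this
    obtain ⟨a, b, g, h, hab, hg, hgA, hgS, hh, hhS⟩ := ih hf'
    set S : Submodule R M := ⨆ k : Fin n, f k.castSucc with hS
    have hdisj : ∀ x ∈ f (Fin.last n), x ∈ S → x = 0 := by
      have h1 := ((indepModulo_bot f).1 hf).2 (Fin.last n)
      have h2 : S ≤ ⨆ (j) (_ : j ≠ Fin.last n), f j :=
        iSup_le fun k => le_iSup₂_of_le k.castSucc k.castSucc_ne_last le_rfl
      exact fun x hx hxS => Submodule.disjoint_def.1 (h1.mono_right h2) x hx hxS
    have hSle : S ≤ ⨆ k, f k := iSup_le fun k => le_iSup f k.castSucc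
    by_cases hB : ∀ (y : Fin b → M) (u : M), (∀ i, y i ∈ h i) → u ∈ f (Fin.last n) →
        ∑ i, y i + u ∈ A → (∀ i, y i = 0) ∧ u = 0
    · refine ⟨a, b + 1, g, Fin.snoc (α := fun _ => Submodule R M) h (f (Fin.last n)), by omega,
        hg, hgA, fun i => (hgS i).trans hSle, ⟨fun i => ?_, fun y hy h0 => ?_⟩, fun i => ?_⟩
      · refine Fin.lastCases ?_ (fun i => ?_) i
        · simpa using hf.1 _
        · simpa using hh.1 i
      · rw [Fin.sum_univ_castSucc] at h0
        obtain ⟨h1, h2⟩ := hB (fun i => y i.castSucc) (y (Fin.last b))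
          (fun i => by simpa using hy i.castSucc) (by simpa using hy (Fin.last b)) h0
        exact fun i => Fin.lastCases h2 h1 i
      · refine Fin.lastCases ?_ (fun i => ?_) i
        · simpa using le_iSup f (Fin.last n)
        · simpa using (hhS i).trans hSle
    · push Not at hB
      obtain ⟨y, u, hy, hu, hA, hne⟩ := hB
      have hsumS : ∀ y : Fin b → M, (∀ i, y i ∈ h i) → ∑ i, y i ∈ ⨆ k, h k := fun y hy =>
        sum_mem fun i _ => Submodule.mem_iSup_of_mem i (hy i)
      have hhS' : ⨆ k, h k ≤ S := iSup_le hhS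
      refine ⟨a + 1, b, Fin.snoc (α := fun _ => Submodule R M) g
        (((⨆ k, h k) ⊔ f (Fin.last n)) ⊓ A), h, by omega, ⟨fun i => ?_, fun z hz h0 => ?_⟩,
        fun i => ?_, fun i => ?_, hh, fun i => (hhS i).trans hSle⟩
      · refine Fin.lastCases ?_ (fun i => ?_) i
        · rw [Fin.snoc_last]
          intro hbot
          have hz : ∑ i, y i + u = 0 := by
            rw [← Submodule.mem_bot R, ← hbot]
            exact ⟨Submodule.add_mem_sup (hsumS y hy) hu, hA⟩
          have hu0 : u = 0 := hdisj u hu (by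
            rw [eq_neg_of_add_eq_zero_right hz]
            exact neg_mem (hhS' (hsumS y hy)))
          have hy0 : ∑ i, y i ∈ A := by
            rw [hu0, add_zero] at hz
            rw [hz]
            exact zero_mem _
          exact hne (hh.2 y hy hy0) hu0
        · simpa using hg.1 i
      · rw [Fin.sum_univ_castSucc, Submodule.mem_bot] at h0
        have hz1 : ∀ i : Fin a, z i.castSucc ∈ g i := fun i => by simpa using hz i.castSucc
        have hz2 : z (Fin.last a) ∈ ((⨆ k, h k) ⊔ f (Fin.last n)) ⊓ A := by
          simpa only [Fin.snoc_last] using hz (Fin.last a)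
        have hzS : z (Fin.last a) ∈ S := by
          rw [eq_neg_of_add_eq_zero_right h0]
          exact neg_mem (sum_mem fun i _ => hgS i (hz1 i))
        obtain ⟨w, hw, v, hv, hwv⟩ := Submodule.mem_sup.1 hz2.1
        have hv0 : v = 0 := hdisj v hv (by
          rw [← add_sub_cancel_left w v, hwv]
          exact sub_mem hzS (hhS' hw))
        rw [hv0, add_zero] at hwv
        obtain ⟨t, ht, rfl⟩ := (Submodule.mem_iSup_iff_exists_finsupp _ _).1 hw
        have htsum : t.sum (fun _ x => x) = ∑ i, t i := t.sum_fintype _ (fun _ => rfl)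
        have ht0 := hh.2 t ht (by rw [← htsum, hwv]; exact hz2.2)
        have hlast : z (Fin.last a) = 0 := by
          rw [← hwv, htsum]
          exact Finset.sum_eq_zero fun i _ => ht0 i
        have h1 := hg.2 (fun i => z i.castSucc) hz1 (by simpa [hlast] using h0)
        exact fun i => Fin.lastCases hlast h1 i
      · refine Fin.lastCases ?_ (fun i => ?_) i
        · rw [Fin.snoc_last]
          exact inf_le_right
        · simpa using hgA i
      · refine Fin.lastCases ?_ (fun i => ?_) i
        · rw [Fin.snoc_last]
          exact inf_le_left.trans (sup_le (hhS'.trans hSle) (le_iSup f _))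
        · simpa using (hgS i).trans hSle

theorem IndepModulo.comap_subtype {ι : Type*} [Fintype ι] {A : Submodule R M}
    {g : ι → Submodule R M} (hg : IndepModulo ⊥ g) (hgA : ∀ i, g i ≤ A) :
    IndepModulo ⊥ fun i => (g i).comap A.subtype := by
  refine ⟨fun i hbot => hg.1 i ?_, fun y hy h0 i => ?_⟩
  · rw [← le_bot_iff, ← Submodule.map_bot A.subtype, ← hbot, Submodule.map_comap_subtype]
    exact le_inf (hgA i) le_rfl
  · have := hg.2 (fun i => (y i : M)) hy (by
      rw [Submodule.mem_bot] at h0 ⊢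
      simpa using congrArg A.subtype h0) i
    exact Subtype.ext this

theorem IndepModulo.map_subtype {ι : Type*} [Fintype ι] {A : Submodule R M}
    {g : ι → Submodule R A} (hg : IndepModulo ⊥ g) :
    IndepModulo ⊥ fun i => (g i).map A.subtype := by
  rw [indepModulo_bot] at hg ⊢
  refine ⟨fun i hbot => hg.1 i ?_, A.subtype.iSupIndep_map A.injective_subtype hg.2⟩
  exact Submodule.map_injective_of_injective A.injective_subtype
    (hbot.trans (Submodule.map_bot _).symm)

end UniformDimension

section Goldie

variable {R : Type*} [Ring R]

/-- The left annihilator of an element, as a left ideal. -/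
def leftAnnihilatorIdeal (a : R) : Ideal R := LinearMap.ker (LinearMap.toSpanSingleton R R a)

@[simp]
theorem mem_leftAnnihilatorIdeal {a x : R} : x ∈ leftAnnihilatorIdeal a ↔ x * a = 0 := by
  simp [leftAnnihilatorIdeal]

theorem leftAnnihilatorIdeal_le_mul_right (a b : R) :
    leftAnnihilatorIdeal a ≤ leftAnnihilatorIdeal (a * b) := fun x hx => by
  rw [mem_leftAnnihilatorIdeal] at hx ⊢
  rw [← mul_assoc, hx, zero_mul]

theorem ACCLeftAnnihilators.wellFoundedGT (h : ACCLeftAnnihilators R) :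
    WellFoundedGT (Set.range (leftAnnihilatorIdeal (R := R))) := by
  rw [wellFoundedGT_iff_monotone_chain_condition]
  intro f
  obtain ⟨N, hN⟩ := h (fun n => ((f n : Ideal R) : Set R))
    (fun n => by
      obtain ⟨a, ha⟩ := (f n).2
      refine ⟨{a}, ?_⟩
      ext x
      simp [leftAnnihilator, ← ha])
    (fun m n hmn => f.mono hmn)
  exact ⟨N, fun m hm => Subtype.ext (SetLike.coe_injective (hN m hm).symm)⟩

/-- Under the ascending chain condition, a nonempty set of elements contains one whose left
annihilator is maximal. -/
theorem ACCLeftAnnihilators.exists_maximal (h : ACCLeftAnnihilators R) {s : Set R}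
    (hs : s.Nonempty) : ∃ a ∈ s, ∀ b ∈ s, leftAnnihilatorIdeal a ≤ leftAnnihilatorIdeal b →
      leftAnnihilatorIdeal b ≤ leftAnnihilatorIdeal a := by
  have := h.wellFoundedGT
  let F : R → Set.range (leftAnnihilatorIdeal (R := R)) := fun a => ⟨_, a, rfl⟩
  obtain ⟨a, ha, hmax⟩ := (InvImage.wf F (wellFounded_gt)).has_min s hs
  refine ⟨a, ha, fun b hb hab => ?_⟩
  by_contra hba
  exact hmax b hb (lt_of_le_not_ge (a := F a) (b := F b) hab hba)

theorem IsSemiprimeRing'.eq_zero_of_forall_mul_mul (h : IsSemiprimeRing' R) {a : R}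
    (ha : ∀ r, a * r * a = 0) : a = 0 := by
  have h1 : ∀ x ∈ TwoSidedIdeal.span {a}, ∀ r, a * r * x = 0 := fun x hx => by
    induction hx using TwoSidedIdeal.span_induction with
    | mem x hx =>
      rw [Set.mem_singleton_iff] at hx
      subst hx
      exact ha
    | zero => simp
    | add x y _ _ hx hy => exact fun r => by rw [mul_add, hx, hy, add_zero]
    | neg x _ hx => exact fun r => by rw [mul_neg, hx, neg_zero]
    | left_absorb s x _ hx => exact fun r => by rw [← mul_assoc, mul_assoc a r s, hx]
    | right_absorb s x _ hx => exact fun r => by rw [← mul_assoc, hx, zero_mul]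
  have h2 : ∀ y ∈ TwoSidedIdeal.span {a}, ∀ x ∈ TwoSidedIdeal.span {a}, y * x = 0 :=
    fun y hy => by
    induction hy using TwoSidedIdeal.span_induction with
    | mem y hy =>
      rw [Set.mem_singleton_iff] at hy
      subst hy
      exact fun x hx => by simpa using h1 x hx 1
    | zero => simp
    | add y z _ _ hy hz => exact fun x hx => by rw [add_mul, hy x hx, hz x hx, add_zero]
    | neg y _ hy => exact fun x hx => by rw [neg_mul, hy x hx, neg_zero]
    | left_absorb s y _ hy => exact fun x hx => by rw [mul_assoc, hy x hx, mul_zero]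
    | right_absorb s y _ hy =>
      exact fun x hx => by rw [mul_assoc, hy _ (TwoSidedIdeal.mul_mem_left _ _ _ hx)]
  have hbot := h (TwoSidedIdeal.span {a}) ⟨2, by norm_num, fun f hf => by
    simpa [List.ofFn_succ] using h2 _ (hf 0) _ (hf 1)⟩
  have hmem : a ∈ TwoSidedIdeal.span {a} := TwoSidedIdeal.subset_span rfl
  rwa [hbot, TwoSidedIdeal.mem_bot] at hmem

/-- A semiprime ring with a.c.c. on left annihilators has no nonzero nil right ideal. -/
theorem IsSemiprimeRing'.eq_zero_of_forall_isNilpotent (h : IsSemiprimeRing' R)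
    (hacc : ACCLeftAnnihilators R) {a : R} (ha : ∀ r, IsNilpotent (a * r)) : a = 0 := by
  by_contra hne
  obtain ⟨_, ⟨⟨t, rfl⟩, hb0⟩, hmax⟩ := hacc.exists_maximal
    (s := {b | (∃ r, a * r = b) ∧ b ≠ 0}) ⟨a, ⟨1, mul_one a⟩, hne⟩
  refine hb0 (h.eq_zero_of_forall_mul_mul fun r => ?_)
  have hnil : IsNilpotent (a * t * r) := by simpa [mul_assoc] using ha (t * r)
  by_cases hz : a * t * r = 0
  · rw [hz, zero_mul]
  have hn0 := pow_nilpotencyClass hnil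
  have : Nontrivial R := ⟨a, 0, hne⟩
  have hpos := pos_nilpotencyClass_iff.2 hnil
  have hpred := pow_pred_nilpotencyClass hnil
  set n := nilpotencyClass (a * t * r)
  have hn1 : n ≠ 1 := fun h1 => hz (by simpa [h1] using hn0)
  obtain ⟨m, hm⟩ : ∃ m, n = m + 2 := ⟨n - 2, by omega⟩
  have hprev : (a * t * r) ^ (m + 1) ≠ 0 := by simpa [hm] using hpred
  have hfac : (a * t * r) ^ (m + 1) = a * t * (r * (a * t * r) ^ m) := by
    rw [pow_succ', mul_assoc]
  have hle := hmax ((a * t * r) ^ (m + 1))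
    ⟨⟨t * (r * (a * t * r) ^ m), by rw [hfac, mul_assoc a t (r * (a * t * r) ^ m)]⟩, hprev⟩
    (by rw [hfac]; exact leftAnnihilatorIdeal_le_mul_right _ _)
  have : a * t * r ∈ leftAnnihilatorIdeal ((a * t * r) ^ (m + 1)) := by
    rw [mem_leftAnnihilatorIdeal, ← pow_succ', ← hm, hn0]
  exact mem_leftAnnihilatorIdeal.1 (hle this)

/-- For some power `n ≥ 1` the left annihilators of `a ^ n` and all higher powers agree. -/
theorem ACCLeftAnnihilators.exists_pow (h : ACCLeftAnnihilators R) (a : R) :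
    ∃ n, 0 < n ∧ ∀ m, leftAnnihilatorIdeal (a ^ (n + m)) ≤ leftAnnihilatorIdeal (a ^ n) := by
  obtain ⟨_, ⟨n, hn, rfl⟩, hmax⟩ := h.exists_maximal (s := {b | ∃ n, 0 < n ∧ a ^ n = b})
    ⟨a, 1, one_pos, pow_one a⟩
  exact ⟨n, hn, fun m => hmax _ ⟨n + m, by omega, rfl⟩
    (by rw [pow_add]; exact leftAnnihilatorIdeal_le_mul_right _ _)⟩

/-- A left singular element is nilpotent under the a.c.c. on left annihilators. -/
theorem ACCLeftAnnihilators.isNilpotent_of_isEssential (h : ACCLeftAnnihilators R) {z : R}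
    (hz : IsEssentialLeftIdeal (leftAnnihilatorIdeal z)) : IsNilpotent z := by
  obtain ⟨n, -, hn⟩ := h.exists_pow z
  refine ⟨n, ?_⟩
  by_contra hne
  refine hz (Ideal.span {z ^ n}) (by simpa using hne) ?_
  rw [eq_bot_iff]
  rintro x ⟨hx1, hx2⟩
  obtain ⟨r, rfl⟩ := Ideal.mem_span_singleton'.1 hx2
  have hr : r ∈ leftAnnihilatorIdeal (z ^ (n + 1)) := by
    rw [mem_leftAnnihilatorIdeal, pow_succ, ← mul_assoc]
    exact mem_leftAnnihilatorIdeal.1 hx1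
  exact mem_leftAnnihilatorIdeal.1 (hn 1 hr)

/-- A semiprime ring with a.c.c. on left annihilators is left nonsingular. -/
theorem IsSemiprimeRing'.eq_zero_of_isEssential (h : IsSemiprimeRing' R)
    (hacc : ACCLeftAnnihilators R) {z : R}
    (hz : IsEssentialLeftIdeal (leftAnnihilatorIdeal z)) : z = 0 :=
  h.eq_zero_of_forall_isNilpotent hacc fun r => hacc.isNilpotent_of_isEssential fun J hJ hbot =>
    hz J hJ (le_bot_iff.1 ((inf_le_inf_right J (leftAnnihilatorIdeal_le_mul_right z r)).trans
      hbot.le))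

/-- A nonzero left ideal contains a nonzero element `a` with `l(a) ∩ R a = 0`. -/
theorem IsSemiprimeRing'.exists_mem_leftAnnihilatorIdeal (h : IsSemiprimeRing' R)
    (hacc : ACCLeftAnnihilators R) {I : Ideal R} (hI : I ≠ ⊥) :
    ∃ a ∈ I, a ≠ 0 ∧ ∀ x, x * a * a = 0 → x * a = 0 := by
  obtain ⟨b, hb, hb0⟩ := I.exists_mem_ne_zero_of_ne_bot hI
  obtain ⟨r, hr⟩ : ∃ r, ¬ IsNilpotent (r * b) := by
    by_contra! hnil
    refine hb0 (h.eq_zero_of_forall_isNilpotent hacc fun r => ?_)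
    obtain ⟨n, hn⟩ := hnil r
    have hconj : SemiconjBy b (r * b) (b * r) := by simp [SemiconjBy, mul_assoc]
    refine ⟨n + 1, ?_⟩
    rw [pow_succ, ← mul_assoc, ← (hconj.pow_right n).eq, hn, mul_zero, zero_mul]
  obtain ⟨n, hn, hmax⟩ := hacc.exists_pow (r * b)
  refine ⟨(r * b) ^ n, ?_, fun h0 => hr ⟨n, h0⟩, fun x hx => ?_⟩
  · obtain ⟨m, rfl⟩ : ∃ m, n = m + 1 := ⟨n - 1, by omega⟩
    rw [pow_succ]
    exact I.mul_mem_left _ (I.mul_mem_left _ hb)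
  · refine mem_leftAnnihilatorIdeal.1 (hmax n ?_)
    rwa [mem_leftAnnihilatorIdeal, pow_add, ← mul_assoc]

/-- With finite uniform dimension there is no infinite descending chain `I n` of left ideals
in which every step `I (n + 1)` misses a nonzero left ideal `X n` of `I n`. -/
theorem HasFiniteLeftUniformDimension.false_of_chain (h : HasFiniteLeftUniformDimension R)
    (I X : ℕ → Ideal R) (hI : ∀ n, I (n + 1) ≤ I n) (hX : ∀ n, X n ≤ I n)
    (hne : ∀ n, X n ≠ ⊥) (hdisj : ∀ n, Disjoint (X n) (I (n + 1))) : False := by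
  refine h ⟨X, hne, (iSupIndep_iff_finsetSum_eq_zero_imp_eq_zero X).2 fun s v hv h0 => ?_⟩
  intro i
  induction i using Nat.strong_induction_on with
  | _ i ih =>
    intro hi
    rw [← s.add_sum_erase _ hi] at h0
    refine Submodule.disjoint_def.1 (hdisj i) _ (hv i hi) ?_
    rw [eq_neg_of_add_eq_zero_left h0]
    refine neg_mem (sum_mem fun j hj => ?_)
    obtain ⟨hji, hjs⟩ := Finset.mem_erase.1 hj
    rcases lt_or_gt_of_ne hji with hlt | hlt
    · rw [ih j hlt hjs]
      exact zero_mem _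
    · exact antitone_nat_of_succ_le hI hlt (hX j (hv j hjs))

theorem HasFiniteLeftUniformDimension.isEssential_span_singleton
    (h : HasFiniteLeftUniformDimension R) {c : R} (hc : ∀ x, x * c = 0 → x = 0) :
    IsEssentialLeftIdeal (Ideal.span {c}) := by
  intro J hJ hbot
  have hcn : ∀ n x, x * c ^ n = 0 → x = 0 := fun n => by
    induction n with
    | zero => simp
    | succ n ih => exact fun x hx => ih x (hc _ (by rwa [mul_assoc, ← pow_succ]))
  refine h.false_of_chain (fun n => Ideal.span {c ^ n})
    (fun n => Submodule.map (LinearMap.toSpanSingleton R R (c ^ n)) J) (fun n => ?_) (fun n => ?_)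
    (fun n hn => ?_) (fun n => ?_)
  · rw [Ideal.span_singleton_le_iff_mem, pow_succ']
    exact Ideal.mul_mem_left _ _ (Ideal.mem_span_singleton_self _)
  · rintro _ ⟨x, -, rfl⟩
    exact Ideal.mul_mem_left _ _ (Ideal.mem_span_singleton_self _)
  · refine hJ (eq_bot_iff.2 fun x hx => hcn n x ?_)
    have : x * c ^ n ∈ Submodule.map (LinearMap.toSpanSingleton R R (c ^ n)) J := ⟨x, hx, rfl⟩
    rwa [hn] at this
  · rw [Submodule.disjoint_def]
    rintro _ ⟨x, hx, rfl⟩ hx2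
    obtain ⟨r, hr⟩ := Ideal.mem_span_singleton'.1 hx2
    change r * c ^ (n + 1) = x * c ^ n at hr
    have hxr : x = r * c := by
      rw [← sub_eq_zero]
      refine hcn n _ ?_
      rw [sub_mul, mul_assoc, ← pow_succ', hr, sub_self]
    have : x ∈ Ideal.span {c} ⊓ J := ⟨hxr ▸ Ideal.mul_mem_left _ _
      (Ideal.mem_span_singleton_self _), hx⟩
    rw [hbot, Submodule.mem_bot] at this
    simp [this]

/-- **Goldie's theorem on regular elements**: an essential left ideal of a semiprime left
Goldie ring contains a regular element. -/
theorem IsEssentialLeftIdeal.exists_isRegular (h : IsSemiprimeRing' R)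
    (hG : IsLeftGoldieRing R) {E : Ideal R} (hE : IsEssentialLeftIdeal E) :
    ∃ c ∈ E, IsRegular c := by
  obtain ⟨hfin, hacc⟩ := hG
  let T := {c : R // c ∈ E ∧ ∀ x, x * c * c = 0 → x * c = 0}
  obtain ⟨⟨c, hcE, hc⟩, hmin⟩ : ∃ c : T, leftAnnihilatorIdeal c.1 ⊓ E = ⊥ := by
    by_contra! hne
    have hstep : ∀ c : T, ∃ c' : T, ∃ X : Ideal R, X ≠ ⊥ ∧
        leftAnnihilatorIdeal c'.1 ≤ leftAnnihilatorIdeal c.1 ∧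
        X ≤ leftAnnihilatorIdeal c.1 ∧ Disjoint X (leftAnnihilatorIdeal c'.1) := by
      rintro ⟨c, hcE, hc⟩
      obtain ⟨a, ⟨hac, haE⟩, ha0, ha⟩ :=
        h.exists_mem_leftAnnihilatorIdeal hacc (hne ⟨c, hcE, hc⟩)
      replace hac : a * c = 0 := mem_leftAnnihilatorIdeal.1 hac
      have hsum : ∀ x, x * (c + a) = 0 → x * c = 0 ∧ x * a = 0 := fun x hx => by
        rw [mul_add] at hx
        have hxc : x * c = 0 := by
          refine hc x ?_
          rw [eq_neg_of_add_eq_zero_left hx, neg_mul, mul_assoc, hac, mul_zero, neg_zero]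
        exact ⟨hxc, by rwa [hxc, zero_add] at hx⟩
      refine ⟨⟨c + a, E.add_mem hcE haE, fun x hx => ?_⟩, Ideal.span {a}, by simpa using ha0,
        fun x hx => ?_, ?_, ?_⟩
      · obtain ⟨h1, h2⟩ := hsum _ hx
        rw [mul_add, add_mul, mul_assoc x a c, hac, mul_zero, add_zero] at h1
        have hxc := hc x h1
        rw [mul_add, hxc, zero_add] at h2 ⊢
        exact ha x h2
      · exact mem_leftAnnihilatorIdeal.2 (hsum x (mem_leftAnnihilatorIdeal.1 hx)).1
      · rw [Ideal.span_singleton_le_iff_mem]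
        exact mem_leftAnnihilatorIdeal.2 hac
      · rw [Submodule.disjoint_def]
        intro x hx hx2
        obtain ⟨r, rfl⟩ := Ideal.mem_span_singleton'.1 hx
        exact ha r (hsum _ (mem_leftAnnihilatorIdeal.1 hx2)).2
    choose succ X hXne hle hXle hXdisj using hstep
    let seq : ℕ → T := fun n => succ^[n] ⟨0, E.zero_mem, by simp⟩
    have hseq : ∀ n, seq (n + 1) = succ (seq n) := fun n => Function.iterate_succ_apply' _ _ _
    refine hfin.false_of_chain (fun n => leftAnnihilatorIdeal (seq n).1) (fun n => X (seq n))
      (fun n => ?_) (fun n => hXle _) (fun n => hXne _) (fun n => ?_)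
    · rw [hseq]
      exact hle _
    · rw [hseq]
      exact hXdisj _
  have hl : ∀ x, x * c = 0 → x = 0 := by
    have hbot : leftAnnihilatorIdeal c = ⊥ := by
      by_contra hne
      exact hE _ hne (by rw [inf_comm]; exact hmin)
    intro x hx
    rwa [← mem_leftAnnihilatorIdeal, hbot] at hx
  refine ⟨c, hcE, isLeftRegular_iff_right_eq_zero_of_mul.2 fun y hy => ?_,
    isRightRegular_iff_left_eq_zero_of_mul.2 hl⟩
  refine h.eq_zero_of_isEssential hacc fun J hJ hbot =>
    hfin.isEssential_span_singleton hl J hJ (le_bot_iff.1 (le_trans (inf_le_inf_right J ?_)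
      hbot.le))
  rw [Ideal.span_singleton_le_iff_mem]
  exact mem_leftAnnihilatorIdeal.2 hy

/-- The right annihilator of a two-sided ideal, as a left ideal. -/
def rightAnnihilatorIdeal (K : Ideal R) [K.IsTwoSided] : Ideal R where
  carrier := {x | ∀ k ∈ K, k * x = 0}
  zero_mem' := by simp
  add_mem' := fun hx hy k hk => by rw [mul_add, hx k hk, hy k hk, add_zero]
  smul_mem' := fun r x hx k hk => by
    rw [smul_eq_mul, ← mul_assoc]
    exact hx _ (K.mul_mem_right _ hk)

theorem IsSemiprimeRing'.disjoint_rightAnnihilatorIdeal (h : IsSemiprimeRing' R)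
    (K : Ideal R) [K.IsTwoSided] : Disjoint K (rightAnnihilatorIdeal K) :=
  Submodule.disjoint_def.2 fun _ hx hx2 =>
    h.eq_zero_of_forall_mul_mul fun r => hx2 _ (K.mul_mem_right r hx)

theorem isEssential_sup_rightAnnihilatorIdeal (K : Ideal R) [K.IsTwoSided] :
    IsEssentialLeftIdeal (K ⊔ rightAnnihilatorIdeal K) := by
  intro J hJ hbot
  refine hJ (le_bot_iff.1 (le_trans (le_inf ?_ le_rfl) hbot.le))
  suffices J ≤ rightAnnihilatorIdeal K from this.trans le_sup_right
  intro x hx k hk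
  rw [← Submodule.mem_bot R, ← hbot]
  exact ⟨Submodule.mem_sup_left (K.mul_mem_right _ hk), J.mul_mem_left _ hx⟩

theorem mem_ker_of_forall_rightAnnihilatorIdeal_mul (h : IsSemiprimeRing' R)
    (hG : IsLeftGoldieRing R) (σ : R →+* R) (hreg : ∀ c : R, IsRegular c → IsRegular (σ c))
    {x : R} (hx : ∀ l ∈ rightAnnihilatorIdeal (RingHom.ker σ), l * x = 0) : σ x = 0 := by
  obtain ⟨c, hc, hcreg⟩ := IsEssentialLeftIdeal.exists_isRegular h hG
    (isEssential_sup_rightAnnihilatorIdeal (RingHom.ker σ))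
  obtain ⟨k, hk, l, hl, rfl⟩ := Submodule.mem_sup.1 hc
  refine isLeftRegular_iff_right_eq_zero_of_mul.1 (hreg _ hcreg).left _ ?_
  rw [← map_mul, add_mul, hx l hl, add_zero, map_mul, (RingHom.mem_ker).1 hk, zero_mul]

end Goldie

section Endomorphism

variable {R S : Type*} [Ring R] [Ring S]

theorem IndepModulo.map_rangeRestrict {ι : Type*} [Fintype ι] {σ : R →+* S} {h : ι → Ideal R}
    (hh : IndepModulo (RingHom.ker σ) h) :
    IndepModulo ⊥ fun i => (h i).map σ.rangeRestrict := by
  have hmem : ∀ i y, y ∈ (h i).map σ.rangeRestrict ↔ ∃ x, x ∈ h i ∧ σ.rangeRestrict x = y :=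
    fun i y => Ideal.mem_map_iff_of_surjective _ σ.rangeRestrict_surjective
  refine ⟨fun i hbot => ?_, fun y hy h0 i => ?_⟩
  · obtain ⟨x, hx, hx0⟩ := (h i).exists_mem_ne_zero_of_ne_bot (hh.1 i)
    refine hx0 (hh.eq_zero_of_mem hx ?_)
    have : σ.rangeRestrict x ∈ (h i).map σ.rangeRestrict := Ideal.mem_map_of_mem _ hx
    have h0 : σ.rangeRestrict x ∈ (⊥ : Ideal σ.range) := hbot ▸ this
    rw [Submodule.mem_bot] at h0
    exact congrArg Subtype.val h0
  · choose x hx hxy using fun i => (hmem i (y i)).1 (hy i)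
    have hx0 := hh.2 x hx (by
      rw [RingHom.mem_ker]
      have : σ.rangeRestrict (∑ i, x i) = 0 := by
        rw [map_sum]
        simpa [hxy] using h0
      exact congrArg Subtype.val this)
    rw [← hxy, hx0, map_zero]

theorem IndepModulo.comap_rangeRestrict {ι : Type*} [Fintype ι] {σ : R →+* S}
    {L : Ideal R} (hdisj : Disjoint (RingHom.ker σ) L)
    (hL : ∀ x, (∀ l ∈ L, l * x = 0) → σ x = 0) (hLr : ∀ l ∈ L, ∀ x, l * x ∈ L)
    {J : ι → Ideal σ.range} (hJ : IndepModulo ⊥ J) :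
    IndepModulo (RingHom.ker σ) fun i => (J i).comap σ.rangeRestrict ⊓ L := by
  refine ⟨fun i hbot => ?_, fun y hy h0 i => ?_⟩
  · obtain ⟨z, hz, hz0⟩ := (J i).exists_mem_ne_zero_of_ne_bot (hJ.1 i)
    obtain ⟨x, rfl⟩ := σ.rangeRestrict_surjective z
    refine hz0 (Subtype.ext (hL x fun l hl => ?_))
    rw [← Submodule.mem_bot R, ← hbot]
    refine ⟨?_, hLr l hl x⟩
    change σ.rangeRestrict (l * x) ∈ J i
    rw [map_mul]
    exact (J i).mul_mem_left _ hz
  · have h1 := hJ.2 (fun i => σ.rangeRestrict (y i)) (fun i => (hy i).1) (by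
      rw [← map_sum, Submodule.mem_bot]
      exact Subtype.ext h0) i
    exact Submodule.disjoint_def.1 hdisj _ (congrArg Subtype.val h1) (hy i).2

end Endomorphism

/-- **Theorem 2.2.(3).** If `R` is a semiprime left Goldie ring and `σ` is a ring
endomorphism of `R` with `σ(C_R) ⊆ C_R`, then
`udim R = udim σ(R) + udim (ker σ)`, where `σ(R)` is regarded as a left module over
itself and `ker σ` as a left `R`-module. -/
theorem udim_eq_udim_image_add_udim_ker {R : Type*} [Ring R]
    (hsemiprime : IsSemiprimeRing' R) (hgoldie : IsLeftGoldieRing R)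
    (σ : R →+* R) (hreg : ∀ c : R, IsRegular c → IsRegular (σ c)) :
    udim R R = udim σ.range σ.range + udim R (RingHom.ker σ) := by
  refine le_antisymm (udim_le fun k f hf => ?_) (udim_add_udim_le fun b a J g hJ hg => ?_)
  · obtain ⟨a, b, g, h, rfl, hg, hgK, -, hh, -⟩ := hf.exists_split (RingHom.ker σ)
    rw [Nat.cast_add, add_comm]
    exact add_le_add hh.map_rangeRestrict.natCast_le_udim
      (hg.comap_subtype hgK).natCast_le_udim
  · have hh := hJ.comap_rangeRestrict
      (hsemiprime.disjoint_rightAnnihilatorIdeal (RingHom.ker σ))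
      (fun x hx => mem_ker_of_forall_rightAnnihilatorIdeal_mul hsemiprime hgoldie σ hreg hx)
      (fun l hl x k hk => by rw [← mul_assoc, hl k hk, zero_mul])
    have := (hg.map_subtype.append (fun i => Submodule.map_subtype_le _ _) hh).natCast_le_udim
    rwa [Nat.cast_add, add_comm] at this
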